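/- Let q be a prime power with q ≡ 3 (mod 4) which is not a prime. Then every irreducible complex character of PSL_2(q) of degree (q−1)/2 is unisingular. -/

import Mathlib

open Module FDRep Matrix CategoryTheory

/-- A finite-dimensional complex representation of a group is *unisingular* if every group
element acts with `1` as an eigenvalue. -/
def FDRep.IsUnisingular {G : Type} [Monoid G] (V : FDRep ℂ G) : Prop :=
  ∀ g : G, Module.End.HasEigenvalue (V.ρ g) 1


/-- `PSL₂(F)`, the projective special linear group of degree 2 over `F`:
the quotient of `SL₂(F)` by its center. -/
abbrev PSL2 (F : Type) [Field F] : Type _ :=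
  Matrix.ProjectiveSpecialLinearGroup (Fin 2) F

namespace PSL2

variable {F : Type} [Field F]

local notation "SL₂" => Matrix.SpecialLinearGroup (Fin 2) F

/-- The upper unitriangular matrix with off-diagonal entry `x`. -/
def upper (x : F) : SL₂ := ⟨!![1, x; 0, 1], by simp⟩

/-- The diagonal matrix `diag(a⁻¹, a)`. -/
def diag (a : Fˣ) : SL₂ := ⟨!![(a⁻¹ : Fˣ), 0; 0, a], by simp⟩

/-- The Weyl element, of determinant one and trace zero. -/
def weyl : SL₂ := ⟨!![0, -1; 1, 0], by simp⟩

lemma coe_upper (x : F) : (upper x : Matrix (Fin 2) (Fin 2) F) = !![1, x; 0, 1] := rfl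

lemma coe_diag (a : Fˣ) :
    (diag a : Matrix (Fin 2) (Fin 2) F) = !![((a⁻¹ : Fˣ) : F), 0; 0, (a : F)] := rfl

lemma coe_weyl : ((weyl : SL₂) : Matrix (Fin 2) (Fin 2) F) = !![0, -1; 1, 0] := rfl

lemma upper_zero : upper (0 : F) = 1 := by
  ext i j; fin_cases i <;> fin_cases j <;> simp [coe_upper]

lemma upper_add (x y : F) : upper (x + y) = upper x * upper y := by
  ext i j; fin_cases i <;> fin_cases j <;> simp [coe_upper, add_comm]

lemma upper_mul_diag (a : Fˣ) (x : F) :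
    upper x * diag a = diag a * upper ((a : F) ^ 2 * x) := by
  ext i j; fin_cases i <;> fin_cases j <;> simp [coe_upper, coe_diag]
  field_simp

lemma diag_mul (a b : Fˣ) : diag (a * b) = diag a * diag b := by
  ext i j; fin_cases i <;> fin_cases j <;> simp [coe_diag, mul_comm]

lemma diag_one : diag (1 : Fˣ) = 1 := by
  ext i j; fin_cases i <;> fin_cases j <;> simp [coe_diag]

lemma diag_neg_one : diag (-1 : Fˣ) = -1 := by
  ext i j; fin_cases i <;> fin_cases j <;> simp [coe_diag]

lemma det_expand (g : SL₂) : g 0 0 * g 1 1 - g 0 1 * g 1 0 = 1 := by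
  rw [← Matrix.det_fin_two]; exact g.det_coe

/-- Matrices with nonzero lower left entry lie in the big Bruhat cell. -/
lemma eq_upper_mul_of_ne_zero (g : SL₂) (h : g 1 0 ≠ 0) :
    g = upper ((g 0 0 - 1) / g 1 0) * (weyl * upper (-g 1 0) * weyl⁻¹) *
      upper ((g 1 1 - 1) / g 1 0) := by
  have := det_expand g
  ext i j
  fin_cases i <;> fin_cases j <;>
    simp [coe_upper, coe_weyl, Matrix.SpecialLinearGroup.coe_inv, adjugate_fin_two,
      Matrix.mul_apply, Fin.sum_univ_two] <;> field_simp <;>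
    grind

/-- A homomorphism killing the upper unitriangular matrices is trivial on `SL₂`. -/
lemma map_eq_one_of_upper {M : Type*} [Monoid M] (f : SL₂ →* M) (h : ∀ x, f (upper x) = 1)
    (g : SL₂) : f g = 1 := by
  have big (g : SL₂) (hg : g 1 0 ≠ 0) : f g = 1 := by
    rw [eq_upper_mul_of_ne_zero g hg]
    simp only [map_mul, h, one_mul, mul_one]
    rw [← map_mul, mul_inv_cancel, map_one]
  by_cases hg : g 1 0 = 0
  · have h1 : f weyl = 1 := big _ (by simp [coe_weyl])
    have h2 : f (weyl * g) = 1 := by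
      apply big
      have := det_expand g
      rw [hg] at this
      have h0 : g 0 0 ≠ 0 := fun h0 ↦ by simp [h0] at this
      simpa [coe_weyl, Matrix.mul_apply] using h0
    rwa [map_mul, h1, one_mul] at h2
  · exact big g hg

lemma conj_apply_one_zero (m g : SL₂) :
    (m⁻¹ * g * m) 1 0 = m 0 0 * (g 1 0 * m 0 0 + g 1 1 * m 1 0)
      - m 1 0 * (g 0 0 * m 0 0 + g 0 1 * m 1 0) := by
  simp [Matrix.SpecialLinearGroup.coe_inv, adjugate_fin_two, Matrix.mul_apply, Fin.sum_univ_two,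
    Matrix.vecMul, dotProduct]
  ring

/-- An upper triangular matrix is conjugate to a diagonal one or unipotent up to sign. -/
lemma upper_triangular_cases (g : SL₂) (h : g 1 0 = 0) :
    (∃ a x, g = upper x * diag a * (upper x)⁻¹) ∨ (∃ x, g = upper x ∨ g = - upper x) := by
  have hdet := det_expand g
  rw [h, mul_zero, sub_zero] at hdet
  by_cases h2 : g 0 0 = g 1 1
  · right
    rw [h2, mul_self_eq_one_iff] at hdet
    rcases hdet with h1 | h1
    · refine ⟨g 0 1, Or.inl ?_⟩
      ext i j; fin_cases i <;> fin_cases j <;> simp [coe_upper, h, h2, h1]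
    · refine ⟨- g 0 1, Or.inr ?_⟩
      ext i j; fin_cases i <;> fin_cases j <;> simp [coe_upper, h, h2, h1]
  · left
    refine ⟨⟨g 1 1, g 0 0, by rw [mul_comm, hdet], hdet⟩, g 0 1 / (g 1 1 - g 0 0), ?_⟩
    have : g 1 1 - g 0 0 ≠ 0 := sub_ne_zero.mpr (Ne.symm h2)
    ext i j; fin_cases i <;> fin_cases j <;>
      simp [coe_upper, coe_diag, Matrix.SpecialLinearGroup.coe_inv, adjugate_fin_two,
      Matrix.mul_apply, Fin.sum_univ_two, h]
    field_simp
    ring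

/-- The discriminant of the characteristic polynomial of `g`. -/
def disc (g : SL₂) : F := (g 0 0 - g 1 1) ^ 2 + 4 * (g 0 1 * g 1 0)

lemma disc_eq_trace_sq (g : SL₂) : disc g = (g 0 0 + g 1 1) ^ 2 - 4 := by
  rw [disc]; linear_combination (-4) * det_expand g

/-- A matrix mapping the point `(1 : 0)` of the projective line to `(y : 1)`. -/
def column (y : F) : SL₂ := ⟨!![y, -1; 1, 0], by simp⟩

lemma coe_column (y : F) : (column y : Matrix (Fin 2) (Fin 2) F) = !![y, -1; 1, 0] := rfl

lemma column_conj_apply (y : F) (g : SL₂) :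
    ((column y)⁻¹ * g * column y) 1 0 = g 1 0 * y ^ 2 + (g 1 1 - g 0 0) * y + -g 0 1 := by
  rw [conj_apply_one_zero]
  simp [coe_column]
  ring

lemma ne_one_and_ne_neg_one_iff (g : SL₂) :
    (g ≠ 1 ∧ g ≠ -1) ↔ (g 1 0 ≠ 0 ∨ g 1 1 - g 0 0 ≠ 0 ∨ -g 0 1 ≠ 0) := by
  have hdet := det_expand g
  constructor
  · contrapose!
    rintro ⟨h1, h2, h3⟩ hg
    have h4 : g 1 1 = g 0 0 := sub_eq_zero.mp h2
    have h5 : g 0 1 = 0 := by simpa using h3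
    rw [h1, h4, mul_zero, sub_zero, mul_self_eq_one_iff] at hdet
    rcases hdet with h | h
    · exact absurd (by ext i j; fin_cases i <;> fin_cases j <;> simp [h, h1, h4, h5]) hg
    · ext i j; fin_cases i <;> fin_cases j <;> simp [h, h1, h4, h5]
  · contrapose!
    intro h
    by_cases h1 : g = 1
    · simp [h1]
    · simp [h h1]

/-- Trace zero matrices proportional to `2 g - tr g` commute with `g`. -/
lemma mul_comm_of_coe_eq (g J : SL₂) (β : F) (hJ : (J : Matrix (Fin 2) (Fin 2) F) =
    !![β * (g 0 0 - g 1 1), 2 * β * g 0 1; 2 * β * g 1 0, - (β * (g 0 0 - g 1 1))]) :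
    J * g = g * J := by
  ext i j
  fin_cases i <;> fin_cases j <;> simp [hJ, Matrix.mul_apply, Fin.sum_univ_two] <;> ring

lemma disc_conj (m g : SL₂) : disc (m⁻¹ * g * m) = disc g := by
  have htr (h : SL₂) : h 0 0 + h 1 1 = Matrix.trace (h : Matrix (Fin 2) (Fin 2) F) := by
    rw [Matrix.trace_fin_two]
  have : Matrix.trace ((m⁻¹ * g * m : SL₂) : Matrix (Fin 2) (Fin 2) F) =
      Matrix.trace (g : Matrix (Fin 2) (Fin 2) F) := by
    rw [Matrix.SpecialLinearGroup.coe_mul, Matrix.trace_mul_comm,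
      ← Matrix.SpecialLinearGroup.coe_mul, mul_inv_cancel_left]
  rw [disc_eq_trace_sq, disc_eq_trace_sq, htr, htr, this]

section BorelWeight

variable [DecidableEq F]

/-- The indicator function of the lower-left entry vanishing, weighted by the discriminant. -/
def borelWeight (g : SL₂) : ℕ := if g 1 0 = 0 then if disc g = 0 then 2 else 1 else 0

lemma borelWeight_upper_mul (x : F) (h : SL₂) : borelWeight (upper x * h) = borelWeight h := by
  by_cases h0 : h 1 0 = 0
  · simp [borelWeight, disc, coe_upper, Matrix.mul_apply, Fin.sum_univ_two, h0]
  · simp [borelWeight, coe_upper, Matrix.mul_apply, Fin.sum_univ_two, h0]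

end BorelWeight

section Finite

variable [Fintype F]

lemma ringChar_ne_two (hq : Fintype.card F % 4 = 3) : ringChar F ≠ 2 := by
  rw [Ne, FiniteField.even_card_iff_char_two]; omega

lemma neg_one_not_isSquare (hq : Fintype.card F % 4 = 3) : ¬ IsSquare (-1 : F) := by
  rw [FiniteField.isSquare_neg_one_iff]; omega

lemma two_ne_zero_of_card (hq : Fintype.card F % 4 = 3) : (2 : F) ≠ 0 :=
  Ring.two_ne_zero (ringChar_ne_two hq)

lemma exists_sq_add_sq (hq : Fintype.card F % 4 = 3) (c : F) : ∃ s y : F, s ^ 2 + y ^ 2 = c := by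
  obtain ⟨a, b, h⟩ := FiniteField.exists_root_sum_quadratic (R := F) (f := Polynomial.X ^ 2)
    (g := Polynomial.X ^ 2 - Polynomial.C c) (Polynomial.degree_X_pow 2)
    (Polynomial.degree_X_pow_sub_C (by decide) _) (by omega)
  refine ⟨a, b, ?_⟩
  simp at h
  linear_combination h

/-- Trace zero elements of `SL₂` form one conjugacy class when `q ≡ 3 (mod 4)`. -/
lemma exists_conj_weyl (hq : Fintype.card F % 4 = 3) (J : SL₂) (hJ : J 0 0 + J 1 1 = 0) :
    ∃ m : SL₂, J = m * weyl * m⁻¹ := by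
  have hdet := det_expand J
  have h11 : J 1 1 = - J 0 0 := by linear_combination hJ
  rw [h11] at hdet
  have hc : J 1 0 ≠ 0 := by
    intro h
    exact neg_one_not_isSquare hq ⟨J 0 0, by rw [h] at hdet; linear_combination hdet⟩
  obtain ⟨s, y, h⟩ := exists_sq_add_sq hq (J 1 0)
  set x := (s + J 0 0 * y) / J 1 0 with hx
  have hs : s = J 1 0 * x - J 0 0 * y := by rw [hx]; field_simp; ring
  obtain ⟨m, hm⟩ : ∃ m : SL₂, (m : Matrix (Fin 2) (Fin 2) F) =
      !![x, J 0 0 * x + J 0 1 * y; y, J 1 0 * x - J 0 0 * y] := by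
    refine ⟨⟨_, ?_⟩, rfl⟩
    rw [det_fin_two_of]
    apply mul_left_cancel₀ hc
    rw [hs] at h
    linear_combination h + y ^ 2 * hdet
  refine ⟨m, eq_mul_inv_of_mul_eq ?_⟩
  ext i j
  fin_cases i <;> fin_cases j <;>
    simp [hm, coe_weyl, Matrix.mul_apply, Fin.sum_univ_two, h11]
  · linear_combination (-x) * hdet
  · ring
  · linear_combination (-y) * hdet

variable [DecidableEq F]

/-- The number of zeros of a binary quadratic form on the projective line. -/
lemma card_projective_zeros (h2 : ringChar F ≠ 2) (a b c : F) (h : a ≠ 0 ∨ b ≠ 0 ∨ c ≠ 0) :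
    (if a = 0 then 1 else 0 : ℤ) + Finset.card {y : F | a * y ^ 2 + b * y + c = 0} =
      1 + quadraticChar F (b ^ 2 - 4 * (a * c)) := by
  have h2' : (2 : F) ≠ 0 := Ring.two_ne_zero h2
  by_cases ha : a = 0
  · subst ha
    by_cases hb : b = 0
    · subst hb
      have hc : c ≠ 0 := by tauto
      simp [hc]
    · have : ({y : F | 0 * y ^ 2 + b * y + c = 0} : Finset F) = {-c / b} := by
        ext y
        simp only [Finset.mem_filter, Finset.mem_univ, true_and, Finset.mem_singleton,
          eq_div_iff hb]
        constructor <;> intro h <;> linear_combination h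
      rw [this]
      simp [quadraticChar_sq_one' hb]
  · rw [if_neg ha, zero_add, add_comm 1, ← quadraticChar_card_sqrts h2, Set.toFinset_ofPred]
    congr 1
    refine Finset.card_nbij' (fun y ↦ 2 * a * y + b) (fun s ↦ (s - b) / (2 * a)) ?_ ?_ ?_ ?_
    · intro y hy
      simp at hy ⊢
      linear_combination 4 * a * hy
    · intro s hs
      simp at hs ⊢
      field_simp
      linear_combination hs
    · intro y _
      simp; field_simp
    · intro s _
      simp; field_simp; ring

/-- The number of trace zero elements of `SL₂` commuting with a noncentral `g`. -/
lemma card_trace_zero_commute (hq : Fintype.card F % 4 = 3) (g : SL₂) (h1 : g ≠ 1)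
    (h2 : g ≠ -1) :
    (Finset.card {J : SL₂ | J 0 0 + J 1 1 = 0 ∧ J * g = g * J} : ℤ) =
      if disc g = 0 then 0 else 1 - quadraticChar F (disc g) := by
  have hg := (ne_one_and_ne_neg_one_iff g).mp ⟨h1, h2⟩
  have two := two_ne_zero_of_card hq
  have key : Finset.card {J : SL₂ | J 0 0 + J 1 1 = 0 ∧ J * g = g * J} =
      Finset.card {β : F | β ^ 2 * disc g = -1} := by
    symm
    refine Finset.card_bij (fun β hβ ↦ (⟨!![β * (g 0 0 - g 1 1), 2 * β * g 0 1;
      2 * β * g 1 0, - (β * (g 0 0 - g 1 1))], ?_⟩ : SL₂)) ?_ ?_ ?_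
    · have hβ := (Finset.mem_filter.mp hβ).2
      rw [disc] at hβ
      rw [det_fin_two_of]
      linear_combination -hβ
    · intro β hβ
      refine Finset.mem_filter.mpr ⟨Finset.mem_univ _, by simp,
        mul_comm_of_coe_eq g _ β rfl⟩
    · intro β hβ β' hβ' h
      have e (i j) := congrArg (fun m : SL₂ ↦ m i j) h
      have e00 := e 0 0
      have e01 := e 0 1
      have e10 := e 1 0
      simp at e00 e01 e10
      grind
    · intro J hJ
      simp only [Finset.mem_filter, Finset.mem_univ, true_and] at hJ
      obtain ⟨hJ, hc⟩ := hJ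
      have h11 : J 1 1 = - J 0 0 := by linear_combination hJ
      have e (i j) := congrArg (fun m : SL₂ ↦ m i j) hc
      have e00 := e 0 0
      have e01 := e 0 1
      have e10 := e 1 0
      simp [Matrix.mul_apply, Fin.sum_univ_two, h11] at e00 e01 e10
      have hdet := det_expand J
      rw [h11] at hdet
      obtain ⟨β, hβ0, hβ1, hβ2⟩ : ∃ β, J 0 0 = β * (g 0 0 - g 1 1) ∧ J 0 1 = 2 * β * g 0 1 ∧
          J 1 0 = 2 * β * g 1 0 := by
        rcases hg with hg | hg | hg
        · refine ⟨J 1 0 / (2 * g 1 0), ?_, ?_, ?_⟩ <;> field_simp <;> grind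
        · have : g 0 0 - g 1 1 ≠ 0 := by intro h; apply hg; linear_combination -h
          refine ⟨J 0 0 / (g 0 0 - g 1 1), ?_, ?_, ?_⟩ <;> field_simp <;> grind
        · have : g 0 1 ≠ 0 := by simpa using hg
          refine ⟨J 0 1 / (2 * g 0 1), ?_, ?_, ?_⟩ <;> field_simp <;> grind
      refine ⟨β, ?_, ?_⟩
      · rw [Finset.mem_filter, disc]
        refine ⟨Finset.mem_univ _, ?_⟩
        rw [hβ0, hβ1, hβ2] at hdet
        linear_combination -hdet
      · ext i j
        fin_cases i <;> fin_cases j <;> simp [h11, hβ0, hβ1, hβ2]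
  rw [key]
  split_ifs with hd
  · simp [hd]
  · have hneg : quadraticChar F (-1) = -1 :=
      quadraticChar_neg_one_iff_not_isSquare.mpr (neg_one_not_isSquare hq)
    have hset : ({β : F | β ^ 2 * disc g = -1} : Finset F) =
        {β : F | β ^ 2 = -1 * (disc g)⁻¹}.toFinset := by
      ext β
      simp [← div_eq_mul_inv, eq_div_iff hd]
    rw [hset, quadraticChar_card_sqrts (ringChar_ne_two hq), map_mul, hneg]
    have : quadraticChar F (disc g)⁻¹ = quadraticChar F (disc g) := by
      have h1 : quadraticChar F (disc g)⁻¹ * quadraticChar F (disc g) = 1 := by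
        rw [← map_mul, inv_mul_cancel₀ hd, map_one]
      rcases quadraticChar_dichotomy hd with h | h <;> rw [h] at h1 ⊢ <;> linarith
    rw [this]; ring

/-- A class-sum coefficient on `SL₂` equal to `2` off the centre. -/
lemma weight_eq_two (hq : Fintype.card F % 4 = 3) (g : SL₂) (h1 : g ≠ 1) (h2 : g ≠ -1) :
    (Finset.card {J : SL₂ | J 0 0 + J 1 1 = 0 ∧ J * g = g * J} : ℤ) +
      (if disc g = 0 then 2 else 1) * ((if g 1 0 = 0 then 1 else 0) +
        Finset.card {y : F | ((column y)⁻¹ * g * column y) 1 0 = 0}) = 2 := by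
  have hg := (ne_one_and_ne_neg_one_iff g).mp ⟨h1, h2⟩
  simp only [column_conj_apply]
  rw [card_trace_zero_commute hq g h1 h2, card_projective_zeros (ringChar_ne_two hq) _ _ _ hg]
  have : (g 1 1 - g 0 0) ^ 2 - 4 * (g 1 0 * -g 0 1) = disc g := by rw [disc]; ring
  rw [this]
  split_ifs with h
  · simp [h]
  · ring

end Finite

section Representation

variable {W : Type*} [AddCommGroup W] [Module ℂ W]
  (σ : Matrix.SpecialLinearGroup (Fin 2) F →* Module.End ℂ W)

lemma upper_diag_apply {ψ : AddChar F ℂ} {v : W} (hv : ∀ x, σ (upper x) v = ψ x • v)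
    (a : Fˣ) (x : F) :
    σ (upper x) (σ (diag a) v) = (ψ.mulShift ((a : F) ^ 2)) x • σ (diag a) v := by
  rw [← Module.End.mul_apply, ← map_mul, upper_mul_diag, map_mul, Module.End.mul_apply, hv,
    map_smul, AddChar.mulShift_apply]

lemma apply_ne_zero {v : W} (g : SL₂) (hv0 : v ≠ 0) : σ g v ≠ 0 := by
  intro h
  apply hv0
  have h1 : σ g⁻¹ (σ g v) = v := by
    rw [← Module.End.mul_apply, ← map_mul, inv_mul_cancel, map_one, Module.End.one_apply]
  rw [← h1, h, map_zero]

/-- Having a nonzero fixed vector is invariant under conjugation. -/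
lemma exists_fixed_of_conj (m g : SL₂) (h : ∃ w : W, w ≠ 0 ∧ σ (m⁻¹ * g * m) w = w) :
    ∃ w : W, w ≠ 0 ∧ σ g w = w := by
  obtain ⟨w, hw, hgw⟩ := h
  refine ⟨σ m w, apply_ne_zero σ m hw, ?_⟩
  conv_rhs => rw [← hgw]
  rw [← Module.End.mul_apply, ← Module.End.mul_apply, ← map_mul, ← map_mul]
  simp [mul_assoc]

variable [Fintype F]

/-- The unnormalised projection onto the `ψ`-eigenspace of the upper unitriangular subgroup. -/
noncomputable def eigenProj (ψ : AddChar F ℂ) : Module.End ℂ W := ∑ x, ψ (-x) • σ (upper x)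

lemma eigenProj_apply_of_eigen {φ : AddChar F ℂ} {v : W} (hv : ∀ x, σ (upper x) v = φ x • v)
    (ψ : AddChar F ℂ) [Decidable (φ = ψ)] :
    eigenProj σ ψ v = if φ = ψ then (Fintype.card F : ℂ) • v else 0 := by
  have h : eigenProj σ ψ v = (∑ x, (φ * ψ⁻¹) x) • v := by
    simp only [eigenProj, LinearMap.sum_apply, LinearMap.smul_apply, hv, smul_smul,
      Finset.sum_smul, AddChar.mul_apply, AddChar.inv_apply, mul_comm]
  classical
  rw [h, AddChar.sum_eq_ite]
  simp only [← AddChar.one_eq_zero, mul_inv_eq_one]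
  split_ifs <;> simp

lemma upper_eigenProj (ψ : AddChar F ℂ) (x : F) (v : W) :
    σ (upper x) (eigenProj σ ψ v) = ψ x • eigenProj σ ψ v := by
  simp only [eigenProj, LinearMap.sum_apply, LinearMap.smul_apply, map_sum, map_smul,
    Finset.smul_sum, smul_smul]
  rw [← Equiv.sum_comp (Equiv.addLeft x)
    (fun y ↦ (ψ x * ψ (-y)) • (σ (upper y)) v)]
  refine Finset.sum_congr rfl fun y _ ↦ ?_
  rw [← Module.End.mul_apply, ← map_mul, ← upper_add, ← AddChar.map_add_eq_mul]
  simp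

lemma sum_eigenProj : ∑ ψ, eigenProj σ ψ = (Fintype.card F : ℂ) • 1 := by
  classical
  simp only [eigenProj]
  rw [Finset.sum_comm]
  simp only [← Finset.sum_smul, AddChar.sum_apply_eq_ite]
  simp [ite_smul, upper_zero]

/-- If the upper unitriangular subgroup acts nontrivially, some nontrivial additive character
occurs in its action. -/
lemma exists_eigenvector (h : ∃ x, σ (upper x) ≠ 1) :
    ∃ (ψ : AddChar F ℂ) (v : W), ψ ≠ 1 ∧ v ≠ 0 ∧ ∀ x, σ (upper x) v = ψ x • v := by
  by_contra! hne
  obtain ⟨x, hx⟩ := h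
  have hzero (ψ : AddChar F ℂ) (hψ : ψ ≠ 1) : eigenProj σ ψ = 0 := by
    ext w
    by_contra hw
    obtain ⟨y, hy⟩ := hne ψ (eigenProj σ ψ w) hψ hw
    exact hy (upper_eigenProj σ ψ y w)
  have hsum := sum_eigenProj σ
  rw [Finset.sum_eq_single 1 (fun ψ _ hψ ↦ hzero ψ hψ) (by simp)] at hsum
  apply hx
  ext w
  have hw := upper_eigenProj σ 1 x w
  rw [hsum] at hw
  simp only [AddChar.one_apply, one_smul, LinearMap.smul_apply, Module.End.one_apply,
    map_smul] at hw
  exact smul_right_injective W (Nat.cast_ne_zero.mpr Fintype.card_ne_zero) hw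

section Eigenvector

variable {ψ : AddChar F ℂ} {v : W}

/-- In dimension `(q - 1) / 2` the upper unitriangular subgroup has no invariants. -/
lemma eigenProj_one_eq_zero [FiniteDimensional ℂ W] (hdim : 2 * finrank ℂ W + 1 = Fintype.card F)
    (hψ : ψ ≠ 1) (hv0 : v ≠ 0) (hv : ∀ x, σ (upper x) v = ψ x • v) :
    eigenProj σ 1 = 0 := by
  classical
  have hprim := AddChar.IsPrimitive.of_ne_one hψ
  let S : Finset F := Finset.univ.image (fun a : Fˣ ↦ (a : F) ^ 2)
  have hS (s : S) : ∃ a : Fˣ, (a : F) ^ 2 = s := by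
    obtain ⟨a, -, ha⟩ := Finset.mem_image.mp s.2
    exact ⟨a, ha⟩
  choose r hr using hS
  let b (s : S) : W := σ (diag (r s)) v
  have hb (s : S) (x : F) : σ (upper x) (b s) = (ψ.mulShift (s : F)) x • b s := by
    rw [← hr s]; exact upper_diag_apply σ hv (r s) x
  have hproj (s t : S) : eigenProj σ (ψ.mulShift (t : F)) (b s) =
      if s = t then (Fintype.card F : ℂ) • b s else 0 := by
    rw [eigenProj_apply_of_eigen σ (hb s)]
    simp only [(AddChar.to_mulShift_inj_of_isPrimitive hprim).eq_iff, Subtype.coe_inj]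
  have hli : LinearIndependent ℂ b := by
    rw [Fintype.linearIndependent_iff]
    intro c hc t
    have h := congrArg (eigenProj σ (ψ.mulShift (t : F))) hc
    simp only [map_sum, map_smul, hproj, map_zero, smul_ite, smul_zero, Finset.sum_ite_eq',
      Finset.mem_univ, if_true, smul_smul] at h
    have hbt : b t ≠ 0 := apply_ne_zero σ _ hv0
    have hq : (Fintype.card F : ℂ) ≠ 0 := Nat.cast_ne_zero.mpr Fintype.card_ne_zero
    simpa [hbt, hq] using h
  have hcard : Fintype.card S = finrank ℂ W := by
    have hle := hli.fintype_card_le_finrank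
    have hge : Finset.card (Finset.univ : Finset Fˣ) ≤ 2 * S.card := by
      refine Finset.card_le_mul_card_image _ 2 fun s hs ↦ ?_
      obtain ⟨a, -, rfl⟩ := Finset.mem_image.mp hs
      calc _ ≤ Finset.card {a, -a} := Finset.card_le_card fun b hb ↦ by
            have hb := (Finset.mem_filter.mp hb).2
            rcases sq_eq_sq_iff_eq_or_eq_neg.mp hb with h | h
            · simp [Units.ext h]
            · simp [show b = -a from Units.ext (by simpa using h)]
        _ ≤ 2 := Finset.card_le_two
    rw [Finset.card_univ, Fintype.card_units] at hge
    rw [Fintype.card_coe] at hle ⊢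
    omega
  have hSne : Nonempty S := ⟨⟨1, Finset.mem_image.mpr ⟨1, by simp, by simp⟩⟩⟩
  refine (basisOfLinearIndependentOfCardEqFinrank hli hcard).ext fun s ↦ ?_
  rw [coe_basisOfLinearIndependentOfCardEqFinrank, eigenProj_apply_of_eigen σ (hb s), if_neg,
    LinearMap.zero_apply]
  refine hprim ?_
  rw [← hr s]
  exact pow_ne_zero 2 (r s).ne_zero

/-- Diagonal elements have nonzero fixed vectors. -/
lemma exists_fixed_diag (hneg : σ (-1) = 1) (hψ : ψ ≠ 1) (hv0 : v ≠ 0)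
    (hv : ∀ x, σ (upper x) v = ψ x • v) (a : Fˣ) :
    ∃ w : W, w ≠ 0 ∧ σ (diag a) w = w := by
  classical
  have hprim := AddChar.IsPrimitive.of_ne_one hψ
  refine ⟨∑ b : Fˣ, σ (diag b) v, ?_, ?_⟩
  · intro h
    have h := congrArg (eigenProj σ ψ) h
    have hcoef (b : Fˣ) : eigenProj σ ψ (σ (diag b) v) =
        (if b = 1 ∨ b = -1 then (Fintype.card F : ℂ) else 0) • v := by
      rw [eigenProj_apply_of_eigen σ (upper_diag_apply σ hv b)]
      have hiff : ψ.mulShift ((b : F) ^ 2) = ψ ↔ b = 1 ∨ b = -1 := by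
        have h := (AddChar.to_mulShift_inj_of_isPrimitive hprim).eq_iff (a := (b : F) ^ 2) (b := 1)
        rw [AddChar.mulShift_one] at h
        rw [h, sq_eq_one_iff, Units.ext_iff, Units.ext_iff, Units.val_neg, Units.val_one]
      simp only [hiff]
      split_ifs with hb
      · rcases hb with rfl | rfl
        · rw [diag_one, map_one, Module.End.one_apply]
        · rw [diag_neg_one, hneg, Module.End.one_apply]
      · simp
    simp only [map_sum, hcoef, ← Finset.sum_smul, map_zero, smul_eq_zero, hv0, or_false,
      Finset.sum_ite, Finset.sum_const_zero, add_zero, Finset.sum_const, nsmul_eq_mul,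
      mul_eq_zero, Nat.cast_eq_zero, Fintype.card_ne_zero, Finset.card_eq_zero] at h
    exact Finset.notMem_empty (1 : Fˣ) (h ▸ Finset.mem_filter.mpr ⟨Finset.mem_univ _, Or.inl rfl⟩)
  · rw [map_sum, ← Equiv.sum_comp (Equiv.mulLeft a) (fun b ↦ σ (diag b) v)]
    refine Finset.sum_congr rfl fun b _ ↦ ?_
    rw [← Module.End.mul_apply, ← map_mul, ← diag_mul]
    rfl

/-- Over a field which is not prime, unipotent elements have nonzero fixed vectors. -/
lemma exists_fixed_upper (hq : Fintype.card F % 4 = 3) (hnp : ¬ (Fintype.card F).Prime)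
    (hv0 : v ≠ 0) (hv : ∀ x, σ (upper x) v = ψ x • v) (x : F) :
    ∃ w : W, w ≠ 0 ∧ σ (upper x) w = w := by
  obtain ⟨c, hc, hcx⟩ : ∃ c : F, c ≠ 0 ∧ ψ (c * x) = 1 := by
    obtain ⟨p, hchar, n, hp, hcard⟩ := FiniteField.card' F
    have hlt : p < Fintype.card F := by
      rw [hcard] at hnp ⊢
      refine lt_self_pow₀ hp.one_lt ?_
      by_contra hn
      have : (n : ℕ) = 1 := le_antisymm (not_lt.mp hn) n.pos
      rw [this, pow_one] at hnp
      exact hnp hp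
    have hroot (c : F) : ψ (c * x) ∈ Polynomial.nthRootsFinset p (1 : ℂ) := by
      rw [Polynomial.mem_nthRootsFinset hp.pos, ← AddChar.map_nsmul_eq_pow]
      simp
    obtain ⟨c, -, d, -, hcd, h⟩ := Finset.exists_ne_map_eq_of_card_lt_of_maps_to
      (s := Finset.univ) (t := Polynomial.nthRootsFinset p (1 : ℂ)) (f := fun c ↦ ψ (c * x))
      (lt_of_le_of_lt ((Multiset.toFinset_card_le _).trans (Polynomial.card_nthRoots p 1))
        (by rwa [Finset.card_univ])) (fun c _ ↦ hroot c)
    refine ⟨c - d, sub_ne_zero.mpr hcd, ?_⟩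
    rw [sub_mul, AddChar.map_sub_eq_div, div_eq_one_iff_eq (ψ.val_isUnit _).ne_zero]
    exact h
  obtain ⟨a, ha⟩ : ∃ a : Fˣ, ψ ((a : F) ^ 2 * x) = 1 := by
    classical
    have hsq : IsSquare c ∨ IsSquare (-c) := by
      by_contra! h
      rw [← quadraticChar_neg_one_iff_not_isSquare, ← quadraticChar_neg_one_iff_not_isSquare,
        ← neg_one_mul c, map_mul, quadraticChar_neg_one_iff_not_isSquare.mpr
          (neg_one_not_isSquare hq)] at h
      omega
    rcases hsq with ⟨a, ha⟩ | ⟨a, ha⟩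
    · refine ⟨Units.mk0 a (by rintro rfl; simp_all), ?_⟩
      rw [Units.val_mk0, sq, ← ha, hcx]
    · refine ⟨Units.mk0 a (by rintro rfl; simp_all), ?_⟩
      rw [Units.val_mk0, sq, ← ha, neg_mul, AddChar.map_neg_eq_inv, hcx, inv_one]
  refine ⟨σ (diag a) v, apply_ne_zero σ _ hv0, ?_⟩
  rw [upper_diag_apply σ hv, AddChar.mulShift_apply, ha, one_smul]

end Eigenvector

section Averages

variable [DecidableEq F]

lemma sum_smul_eq_zero (hP : eigenProj σ 1 = 0) (φ : SL₂ → ℂ)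
    (hφ : ∀ x h, φ (upper x * h) = φ h) : ∑ h, φ h • σ h = 0 := by
  have hx (x : F) : σ (upper x) * ∑ h, φ h • σ h = ∑ h, φ h • σ h := by
    rw [Finset.mul_sum]
    conv_rhs => rw [← Equiv.sum_comp (Equiv.mulLeft (upper x))]
    simp [hφ]
  have hmul : eigenProj σ 1 * ∑ h, φ h • σ h = (Fintype.card F : ℂ) • ∑ h, φ h • σ h := by
    simp only [eigenProj, AddChar.one_apply, one_smul, Finset.sum_mul, hx]
    rw [Finset.sum_const, Finset.card_univ, Nat.cast_smul_eq_nsmul]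
  rw [hP, zero_mul, eq_comm, smul_eq_zero] at hmul
  exact hmul.resolve_left (Nat.cast_ne_zero.mpr Fintype.card_ne_zero)

lemma sum_conj_eq (φ : SL₂ → ℂ) (m : SL₂) :
    ∑ g, φ (m⁻¹ * g * m) • σ g = σ m * (∑ h, φ h • σ h) * σ m⁻¹ := by
  rw [← Equiv.sum_comp (MulAut.conj m).toEquiv (fun g ↦ φ (m⁻¹ * g * m) • σ g),
    Finset.mul_sum, Finset.sum_mul]
  refine Finset.sum_congr rfl fun h _ ↦ ?_
  simp [mul_assoc]

/-- The unnormalised projection onto the invariants of the centraliser of `J`. -/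
noncomputable def centralizerSum (J : SL₂) : Module.End ℂ W :=
  ∑ g, (if J * g = g * J then 1 else 0 : ℂ) • σ g

lemma mul_centralizerSum (J h : SL₂) (hJ : J * h = h * J) :
    σ h * centralizerSum σ J = centralizerSum σ J := by
  rw [centralizerSum, Finset.mul_sum]
  conv_rhs => rw [← Equiv.sum_comp (Equiv.mulLeft h)]
  refine Finset.sum_congr rfl fun g _ ↦ ?_
  have : J * (h * g) = h * g * J ↔ J * g = g * J := by
    rw [← mul_assoc, hJ, mul_assoc, mul_assoc, mul_right_inj]
  simp [this]

lemma centralizerSum_conj (m J : SL₂) :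
    centralizerSum σ (m * J * m⁻¹) = σ m * centralizerSum σ J * σ m⁻¹ := by
  rw [centralizerSum, centralizerSum, ← sum_conj_eq]
  refine Finset.sum_congr rfl fun g _ ↦ ?_
  congr 2
  rw [eq_iff_iff, ← (MulAut.conj m⁻¹).injective.eq_iff]
  simp [mul_assoc]

/-- The weight of `weight_eq_two`, as a function on the whole group. -/
def weight (g : SL₂) : ℕ :=
  Finset.card {J : SL₂ | J 0 0 + J 1 1 = 0 ∧ J * g = g * J} +
    (borelWeight g + ∑ y, borelWeight ((column y)⁻¹ * g * column y))

lemma weight_eq (hq : Fintype.card F % 4 = 3) (g : SL₂) (h1 : g ≠ 1) (h2 : g ≠ -1) :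
    weight g = 2 := by
  have h := weight_eq_two hq g h1 h2
  have hsum : ∑ y, borelWeight ((column y)⁻¹ * g * column y) = (if disc g = 0 then 2 else 1) *
      Finset.card {y : F | ((column y)⁻¹ * g * column y) 1 0 = 0} := by
    simp only [borelWeight, disc_conj]
    rw [← Finset.sum_filter, Finset.sum_const, smul_eq_mul, mul_comm]
  rw [weight, hsum, borelWeight]
  zify
  refine Eq.trans ?_ h
  split_ifs <;> ring

lemma sum_weight_smul (hP : eigenProj σ 1 = 0) :
    ∑ g, (weight g : ℂ) • σ g =
      ∑ J : SL₂ with J 0 0 + J 1 1 = 0, centralizerSum σ J := by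
  have hB : ∑ h, (borelWeight h : ℂ) • σ h = 0 :=
    sum_smul_eq_zero σ hP _ fun x h ↦ by rw [borelWeight_upper_mul]
  have hBy (y : F) : ∑ h, (borelWeight ((column y)⁻¹ * h * column y) : ℂ) • σ h = 0 := by
    rw [sum_conj_eq σ (fun h ↦ (borelWeight h : ℂ)), hB, mul_zero, zero_mul]
  have hBs : ∑ h, ∑ y, (borelWeight ((column y)⁻¹ * h * column y) : ℂ) • σ h = 0 := by
    rw [Finset.sum_comm]
    exact Finset.sum_eq_zero fun y _ ↦ hBy y
  simp only [weight, Nat.cast_add, Nat.cast_sum, add_smul, Finset.sum_add_distrib,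
    Finset.sum_smul, hB, hBs, add_zero, centralizerSum]
  rw [Finset.sum_comm]
  refine Finset.sum_congr rfl fun g _ ↦ ?_
  rw [← Finset.sum_smul, ← Finset.filter_filter, Finset.card_filter]
  simp

lemma sum_centralizerSum_ne_zero [Nontrivial W] (hq : Fintype.card F % 4 = 3)
    (hneg : σ (-1) = 1) (hP : eigenProj σ 1 = 0) (hG : ∑ g, σ g = 0) :
    ∑ J : SL₂ with J 0 0 + J 1 1 = 0, centralizerSum σ J ≠ 0 := by
  have hne : (1 : SL₂) ≠ -1 := by
    intro h
    have h := congrArg (fun g : SL₂ ↦ g 0 0 + 1) h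
    simp [one_add_one_eq_two, two_ne_zero_of_card hq] at h
  have h1 : 2 < weight (1 : SL₂) := by
    simp [weight, borelWeight, disc]
    have := Fintype.card_pos (α := F)
    omega
  have h2 : 2 < weight (-1 : SL₂) := by
    simp [weight, borelWeight, disc]
    have := Fintype.card_pos (α := F)
    omega
  rw [← sum_weight_smul σ hP]
  have hw (g : SL₂) : (weight g : ℂ) • σ g = (2 : ℂ) • σ g +
      ((if g = 1 then ((weight (1 : SL₂) : ℂ) - 2) • σ 1 else 0) +
        (if g = -1 then ((weight (-1 : SL₂) : ℂ) - 2) • σ (-1) else 0)) := by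
    by_cases hg1 : g = 1
    · subst hg1; simp [hne, ← add_smul]
    by_cases hg2 : g = -1
    · subst hg2; simp [hne.symm, ← add_smul]
    · simp [hg1, hg2, weight_eq hq g hg1 hg2]
  simp only [hw, Finset.sum_add_distrib, ← Finset.smul_sum, hG, Finset.sum_ite_eq',
    Finset.mem_univ, if_true, smul_zero, zero_add, hneg, map_one, ← add_smul]
  refine smul_ne_zero ?_ one_ne_zero
  intro h
  have h' : weight (1 : SL₂) + weight (-1 : SL₂) = 4 := by
    exact_mod_cast (by linear_combination h :
      (weight (1 : SL₂) : ℂ) + (weight (-1 : SL₂) : ℂ) = 4)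
  omega

lemma centralizerSum_ne_zero [Nontrivial W] (hq : Fintype.card F % 4 = 3)
    (hneg : σ (-1) = 1) (hP : eigenProj σ 1 = 0) (hG : ∑ g, σ g = 0)
    (J : SL₂) (hJ : J 0 0 + J 1 1 = 0) : centralizerSum σ J ≠ 0 := by
  have hweyl : centralizerSum σ weyl ≠ 0 := by
    intro h
    refine sum_centralizerSum_ne_zero σ hq hneg hP hG (Finset.sum_eq_zero fun K hK ↦ ?_)
    obtain ⟨m, rfl⟩ := exists_conj_weyl hq K (Finset.mem_filter.mp hK).2
    rw [centralizerSum_conj, h, mul_zero, zero_mul]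
  obtain ⟨m, rfl⟩ := exists_conj_weyl hq J hJ
  rw [centralizerSum_conj]
  intro h
  apply hweyl
  have h' := congrArg (fun A ↦ σ m⁻¹ * A * σ m) h
  simpa [mul_assoc, ← map_mul, mul_assoc, ← mul_assoc (σ m⁻¹)] using h'

lemma exists_fixed_of_commute [Nontrivial W] (hq : Fintype.card F % 4 = 3)
    (hneg : σ (-1) = 1) (hP : eigenProj σ 1 = 0) (hG : ∑ g, σ g = 0)
    (g J : SL₂) (hJ : J 0 0 + J 1 1 = 0) (hJg : J * g = g * J) :
    ∃ w : W, w ≠ 0 ∧ σ g w = w := by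
  obtain ⟨u, hu⟩ : ∃ u, centralizerSum σ J u ≠ 0 := by
    by_contra! h
    exact centralizerSum_ne_zero σ hq hneg hP hG J hJ (LinearMap.ext h)
  exact ⟨_, hu, by rw [← Module.End.mul_apply, mul_centralizerSum σ J g hJg]⟩

end Averages

/-- Elements of the Borel subgroup have nonzero fixed vectors. -/
lemma exists_fixed_of_lower_eq_zero (hq : Fintype.card F % 4 = 3)
    (hnp : ¬ (Fintype.card F).Prime) (hneg : σ (-1) = 1) {ψ : AddChar F ℂ} {v : W} (hψ : ψ ≠ 1)
    (hv0 : v ≠ 0) (hv : ∀ x, σ (upper x) v = ψ x • v) (g : SL₂) (hg : g 1 0 = 0) :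
    ∃ w : W, w ≠ 0 ∧ σ g w = w := by
  rcases upper_triangular_cases g hg with ⟨a, x, rfl⟩ | ⟨x, rfl | rfl⟩
  · refine exists_fixed_of_conj σ (upper x) _ ?_
    simpa [mul_assoc] using exists_fixed_diag σ hneg hψ hv0 hv a
  · exact exists_fixed_upper σ hq hnp hv0 hv x
  · rw [← neg_one_mul, map_mul, hneg, one_mul]
    exact exists_fixed_upper σ hq hnp hv0 hv x

/-- If every endomorphism commuting with a representation of `SL₂(q)` of dimension `(q - 1) / 2` is
scalar and `-1` acts trivially, then every element has a nonzero fixed vector. -/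
lemma exists_fixed [FiniteDimensional ℂ W] (hq : Fintype.card F % 4 = 3)
    (hnp : ¬ (Fintype.card F).Prime) (hneg : σ (-1) = 1)
    (hdim : 2 * finrank ℂ W + 1 = Fintype.card F)
    (hschur : ∀ A : Module.End ℂ W, (∀ g, A * σ g = σ g * A) → ∃ c : ℂ, A = c • 1) (g : SL₂) :
    ∃ w : W, w ≠ 0 ∧ σ g w = w := by
  classical
  have hdim1 : 1 < finrank ℂ W := by
    by_contra hle
    have : Fintype.card F = 3 := by omega
    exact hnp (this ▸ Nat.prime_three)
  have : Nontrivial W := Module.nontrivial_of_finrank_pos (zero_lt_one.trans hdim1)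
  have hnontriv : ∃ h, σ h ≠ 1 := by
    by_contra! htriv
    have hscalar (A : Module.End ℂ W) : ∃ c : ℂ, A = c • 1 :=
      hschur A fun h ↦ by rw [htriv, mul_one, one_mul]
    have hend : finrank ℂ (Module.End ℂ W) ≤ 1 :=
      finrank_le_one 1 fun A ↦ (hscalar A).imp fun _ ↦ Eq.symm
    rw [Module.finrank_linearMap] at hend
    nlinarith
  have hU : ∃ x, σ (upper x) ≠ 1 := by
    by_contra! h
    obtain ⟨h', hh'⟩ := hnontriv
    exact hh' (map_eq_one_of_upper σ h h')
  obtain ⟨ψ, v, hψ, hv0, hv⟩ := exists_eigenvector σ hU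
  have hP := eigenProj_one_eq_zero σ hdim hψ hv0 hv
  have hG : ∑ h, σ h = 0 := by
    simpa using sum_smul_eq_zero σ hP (fun _ ↦ 1) fun _ _ ↦ rfl
  by_cases h1 : g = 1
  · exact ⟨v, hv0, by rw [h1, map_one, Module.End.one_apply]⟩
  by_cases h2 : g = -1
  · exact ⟨v, hv0, by rw [h2, hneg, Module.End.one_apply]⟩
  by_cases h0 : g 1 0 = 0
  · exact exists_fixed_of_lower_eq_zero σ hq hnp hneg hψ hv0 hv g h0
  by_cases hy : ∃ y : F, ((column y)⁻¹ * g * column y) 1 0 = 0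
  · obtain ⟨y, hy⟩ := hy
    exact exists_fixed_of_conj σ _ _
      (exists_fixed_of_lower_eq_zero σ hq hnp hneg hψ hv0 hv _ hy)
  · push Not at hy
    have hcard := weight_eq_two hq g h1 h2
    simp only [h0, hy, if_false, Finset.filter_false, Finset.card_empty, Nat.cast_zero, add_zero,
      mul_zero] at hcard
    obtain ⟨J, hJ⟩ := Finset.card_pos.mp (by omega :
      0 < Finset.card {J : SL₂ | J 0 0 + J 1 1 = 0 ∧ J * g = g * J})
    obtain ⟨hJ0, hJg⟩ := (Finset.mem_filter.mp hJ).2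
    exact exists_fixed_of_commute σ hq hneg hP hG g J hJ0 hJg

end Representation

/-- Schur's lemma for simple objects of `FDRep ℂ G`. -/
lemma exists_eq_smul_one {G : Type} [Group G] (V : FDRep ℂ G) [Simple V] (A : Module.End ℂ V)
    (hA : ∀ g, A * V.ρ g = V.ρ g * A) : ∃ c : ℂ, A = c • 1 := by
  let f : V ⟶ V := ⟨InducedCategory.homMk (ModuleCat.ofHom A), fun g ↦ by
    ext w
    exact LinearMap.congr_fun (hA g) w⟩
  obtain ⟨c, hc⟩ := endomorphism_simple_eq_smul_id ℂ f
  refine ⟨c, LinearMap.ext fun w ↦ ?_⟩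
  have := congrArg (fun f : V ⟶ V ↦ f.hom.hom w) hc
  exact this.symm

end PSL2

/-- Let `F` be a finite field with `q` elements, where `q ≡ 3 (mod 4)` and
`q` is not a prime. Every irreducible complex character of `PSL₂(q)` of degree
`(q - 1) / 2` is unisingular. -/
theorem PSL2_unisingular_of_deg_half_q_sub_one (q : ℕ) (hq : q % 4 = 3) (hnp : ¬ q.Prime)
    (F : Type) [Field F] [Fintype F] (hF : Fintype.card F = q)
    (V : FDRep ℂ (PSL2 F)) (hV : Simple V)
    (hdeg : Module.finrank ℂ V = (q - 1) / 2) :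
    V.IsUnisingular := by
  subst hF
  intro g
  let σ : Matrix.SpecialLinearGroup (Fin 2) F →* Module.End ℂ V :=
    V.ρ.comp (QuotientGroup.mk' _)
  have hneg : σ (-1) = 1 := by
    have hmem : (-1 : Matrix.SpecialLinearGroup (Fin 2) F) ∈
        Subgroup.center (Matrix.SpecialLinearGroup (Fin 2) F) :=
      Subgroup.mem_center_iff.mpr fun h ↦ by rw [mul_neg_one, neg_one_mul]
    have : (QuotientGroup.mk' (Subgroup.center (Matrix.SpecialLinearGroup (Fin 2) F))) (-1) = 1 :=
      (QuotientGroup.eq_one_iff _).mpr hmem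
    exact (congrArg V.ρ this).trans (map_one _)
  obtain ⟨g, rfl⟩ := QuotientGroup.mk'_surjective _ g
  obtain ⟨w, hw, hgw⟩ := PSL2.exists_fixed σ hq hnp hneg (by omega)
    (fun A hA ↦ PSL2.exists_eq_smul_one V A fun h ↦ by
      obtain ⟨h, rfl⟩ := QuotientGroup.mk'_surjective _ h
      exact hA h) g
  exact Module.End.hasEigenvalue_of_hasEigenvector
    ⟨Module.End.mem_eigenspace_iff.mpr (hgw.trans (one_smul ℂ w).symm), hw⟩
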